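/- For all ε > 0, σ_x > 0, σ_k > 0 and all Schwartz functions f, g : ℝ → ℂ, the smoothed Wigner transform of the pair (ε f', g) satisfies, for every (x,k) ∈ ℝ²: W̃^{σ_x,σ_k;ε}[ε f', g](x,k) = 2πik·W̃^{σ_x,σ_k;ε}[f,g](x,k) + (ε/2)·∂_x W̃^{σ_x,σ_k;ε}[f,g](x,k) + (iε σ_k²/2)·∂_k W̃^{σ_x,σ_k;ε}[f,g](x,k). -/

import Mathlib

open Real MeasureTheory

/-- The scaled Wigner transform `W^ε[f,g](x,k) = ∫ e^{-2πiky} f(x+εy/2) conj(g(x-εy/2)) dy`. -/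
noncomputable def wigner (ε : ℝ) (f g : ℝ → ℂ) (x k : ℝ) : ℂ :=
  ∫ y : ℝ, Complex.exp (-(2 * π * Complex.I * k * y)) *
    f (x + ε * y / 2) * (starRingEnd ℂ) (g (x - ε * y / 2))

/-- The smoothed Wigner transform: the Wigner transform convolved with the normalized Gaussian
kernel `(2/(ε σx σk)) exp(-2π(x-x')²/(ε σx²) - 2π(k-k')²/(ε σk²))`. -/
noncomputable def swt (ε σx σk : ℝ) (f g : ℝ → ℂ) (x k : ℝ) : ℂ :=
  (2 / (ε * σx * σk) : ℂ) *
    ∫ x' : ℝ, ∫ k' : ℝ,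
      (Real.exp (-(2 * π * (x - x')^2 / (ε * σx^2)) - 2 * π * (k - k')^2 / (ε * σk^2)) : ℂ) *
        wigner ε f g x' k'

/-- Gaussian kernel. -/
noncomputable def gs (a x t : ℝ) : ℂ := (Real.exp (-(a * (x - t) ^ 2)) : ℂ)

/-- Derivative in `x` of the Gaussian kernel. -/
noncomputable def gs' (a x t : ℝ) : ℂ := (((-2 * a * (x - t)) * Real.exp (-(a * (x - t) ^ 2)) : ℝ) : ℂ)

lemma gs_integrable {a : ℝ} (ha : 0 < a) (x : ℝ) : Integrable (gs a x) := by
  have h := ((integrable_exp_neg_mul_sq ha).comp_sub_left x).ofReal (𝕜 := ℂ)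
  refine h.congr (Filter.Eventually.of_forall fun t => ?_)
  simp [gs]

lemma gs'_integrable {a : ℝ} (ha : 0 < a) (x : ℝ) : Integrable (gs' a x) := by
  have h := (((integrable_mul_exp_neg_mul_sq ha).comp_sub_left x).const_mul (-2 * a)).ofReal (𝕜 := ℂ)
  refine h.congr (Filter.Eventually.of_forall fun t => ?_)
  simp [gs', mul_assoc]

lemma gs_cont (a x : ℝ) : Continuous (gs a x) := by unfold gs; fun_prop
lemma gs'_cont (a x : ℝ) : Continuous (gs' a x) := by unfold gs'; fun_prop

lemma gs_hasDeriv (a x t : ℝ) : HasDerivAt (fun x => gs a x t) (gs' a x t) x := by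
  unfold gs gs'
  apply HasDerivAt.ofReal_comp
  have h : HasDerivAt (fun x : ℝ => -(a * (x - t) ^ 2)) (-2 * a * (x - t)) x := by
    have := ((((hasDerivAt_id x).sub_const t).pow 2).const_mul a).neg
    exact this.congr_deriv (by simp; ring)
  convert h.exp using 1
  ring

lemma gs_hasDeriv_right (a x t : ℝ) : HasDerivAt (gs a x) (-gs' a x t) t := by
  have h := gs_hasDeriv a t x
  have e : (fun s => gs a s x) = gs a x := by
    funext s; unfold gs; congr 3; ring
  rw [e] at h
  convert h using 1
  unfold gs'
  rw [← Complex.ofReal_neg]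
  congr 1
  rw [show (t - x)^2 = (x-t)^2 by ring]; ring

lemma bdd_int {u F : ℝ → ℂ} (hu : Integrable u) (hF : StronglyMeasurable F) {M : ℝ}
    (hM : ∀ t, ‖F t‖ ≤ M) : Integrable (fun t => u t * F t) :=
  hu.mul_bdd (c := M) hF.aestronglyMeasurable (Filter.Eventually.of_forall hM)

lemma gi_hasDeriv {a : ℝ} (ha : 0 < a) {F : ℝ → ℂ} (hF : StronglyMeasurable F) {M : ℝ}
    (hM : ∀ t, ‖F t‖ ≤ M) (x₀ : ℝ) :
    HasDerivAt (fun x => ∫ t, gs a x t * F t) (∫ t, gs' a x₀ t * F t) x₀ := by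
  have hM0 : 0 ≤ M := (norm_nonneg _).trans (hM 0)
  have ha2 : 0 < a / 2 := by positivity
  refine (hasDerivAt_integral_of_dominated_loc_of_deriv_le (𝕜 := ℝ)
    (F := fun x t => gs a x t * F t) (F' := fun x t => gs' a x t * F t)
    (bound := fun t => (2 * a * Real.exp a * M) * (|x₀ - t| * Real.exp (-(a / 2) * (x₀ - t) ^ 2)
      + Real.exp (-(a / 2) * (x₀ - t) ^ 2)))
    (Metric.ball_mem_nhds x₀ one_pos) ?_ ?_ ?_ ?_ ?_ ?_).2
  · exact Filter.Eventually.of_forall fun x =>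
      ((gs_cont a x).stronglyMeasurable.mul hF).aestronglyMeasurable
  · exact bdd_int (gs_integrable ha _) hF hM
  · exact ((gs'_cont a _).stronglyMeasurable.mul hF).aestronglyMeasurable
  · refine Filter.Eventually.of_forall fun t x hx => ?_
    rw [Metric.mem_ball, Real.dist_eq] at hx
    have h1 : |x - t| ≤ |x₀ - t| + 1 := by
      calc |x - t| = |(x - x₀) + (x₀ - t)| := by ring_nf
        _ ≤ |x - x₀| + |x₀ - t| := abs_add_le _ _
        _ ≤ _ := by linarith
    have h2 : -(a * (x - t) ^ 2) ≤ a + -(a / 2) * (x₀ - t) ^ 2 := by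
      have : (x - x₀) ^ 2 ≤ 1 := by
        rw [← sq_abs]; nlinarith [abs_nonneg (x - x₀)]
      have : (x₀ - t) ^ 2 ≤ 2 * (x - t) ^ 2 + 2 := by
        nlinarith [sq_nonneg ((x - t) + (x - x₀))]
      nlinarith
    rw [norm_mul]
    unfold gs'
    rw [Complex.norm_real, norm_mul, Real.norm_eq_abs, Real.norm_eq_abs, Real.abs_exp]
    have h3 : |-2 * a * (x - t)| = 2 * a * |x - t| := by
      rw [abs_mul]; congr 1; rw [abs_mul, abs_of_pos ha]; norm_num
    rw [h3]
    calc 2 * a * |x - t| * Real.exp (-(a * (x - t) ^ 2)) * ‖F t‖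
        ≤ 2 * a * (|x₀ - t| + 1) * Real.exp (a + -(a / 2) * (x₀ - t) ^ 2) * M := by
          gcongr
          exact hM t
      _ = _ := by rw [Real.exp_add]; ring
  · refine Integrable.const_mul (Integrable.add ?_ ((integrable_exp_neg_mul_sq ha2).comp_sub_left x₀)) _
    refine ((integrable_mul_exp_neg_mul_sq ha2).comp_sub_left x₀).norm.congr
      (Filter.Eventually.of_forall fun t => ?_)
    simp
  · exact Filter.Eventually.of_forall fun t x _ => (gs_hasDeriv a x t).mul_const _

lemma prod_int {u v : ℝ → ℂ} (hu : Integrable u) (hv : Integrable v) {F : ℝ → ℝ → ℂ}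
    (hF : StronglyMeasurable (Function.uncurry F)) {M : ℝ} (hM : ∀ x k, ‖F x k‖ ≤ M) :
    Integrable (Function.uncurry fun x k => u x * (v k * F x k)) (volume.prod volume) := by
  have h := (hu.mul_prod hv).mul_bdd (c := M) (g := Function.uncurry F) hF.aestronglyMeasurable
    (Filter.Eventually.of_forall fun p => hM p.1 p.2)
  refine h.congr (Filter.Eventually.of_forall fun p => ?_)
  simp [Function.uncurry, mul_assoc]

lemma swap_int {u v : ℝ → ℂ} (hu : Integrable u) (hv : Integrable v) {F : ℝ → ℝ → ℂ}
    (hF : StronglyMeasurable (Function.uncurry F)) {M : ℝ} (hM : ∀ x k, ‖F x k‖ ≤ M) :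
    ∫ x, u x * ∫ k, v k * F x k = ∫ k, v k * ∫ x, u x * F x k := by
  have := integral_integral_swap (prod_int hu hv hF hM)
  simp_rw [← integral_const_mul]
  rw [this]
  congr 1; ext k; congr 1; ext x; ring

lemma inner_bound {v F : ℝ → ℂ} (hv : Integrable v) {M : ℝ} (hM : ∀ t, ‖F t‖ ≤ M) :
    ‖∫ k, v k * F k‖ ≤ (∫ k, ‖v k‖) * M := by
  rw [← integral_mul_const]
  refine norm_integral_le_of_norm_le (hv.norm.mul_const M) (Filter.Eventually.of_forall fun t => ?_)
  rw [norm_mul]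
  gcongr
  exact hM t

lemma lin3 {u v w : ℝ → ℂ} (hu : Integrable u) (hv : Integrable v) (hw : Integrable w)
    (a b c : ℂ) : ∫ t, (a * u t + b * v t + c * w t) =
      a * (∫ t, u t) + b * (∫ t, v t) + c * ∫ t, w t := by
  have h1 : Integrable fun t => a * u t + b * v t := (hu.const_mul a).add (hv.const_mul b)
  rw [integral_add h1 (hw.const_mul c), integral_add (hu.const_mul a) (hv.const_mul b),
    integral_const_mul, integral_const_mul, integral_const_mul]

lemma core {a b : ℝ} (ha : 0 < a) (hb : 0 < b) {W D : ℝ → ℝ → ℂ}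
    (hW : StronglyMeasurable (Function.uncurry W)) (hD : StronglyMeasurable (Function.uncurry D))
    {M N : ℝ} (hM : ∀ x k, ‖W x k‖ ≤ M) (hN : ∀ x k, ‖D x k‖ ≤ N)
    (hWD : ∀ x k, HasDerivAt (fun x => W x k) (D x k) x) (e : ℂ) (x k : ℝ) :
    ∫ x', gs a x x' * ∫ k', gs b k k' * (2 * π * Complex.I * k' * W x' k' + e * D x' k') =
      2 * π * Complex.I * k * (∫ x', gs a x x' * ∫ k', gs b k k' * W x' k')
      + e * deriv (fun x => ∫ x', gs a x x' * ∫ k', gs b k k' * W x' k') x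
      + π * Complex.I / b * deriv (fun k => ∫ x', gs a x x' * ∫ k', gs b k k' * W x' k') k := by
  have hWx : ∀ x, StronglyMeasurable (W x) := fun x => hW.comp_measurable measurable_prodMk_left
  have hWk : ∀ k, StronglyMeasurable (fun x => W x k) :=
    fun k => hW.comp_measurable measurable_prodMk_right
  have hDx : ∀ x, StronglyMeasurable (D x) := fun x => hD.comp_measurable measurable_prodMk_left
  have hDk : ∀ k, StronglyMeasurable (fun x => D x k) :=
    fun k => hD.comp_measurable measurable_prodMk_right
  have ga := gs_integrable ha x
  have ga' := gs'_integrable ha x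
  have gb := gs_integrable hb k
  have gb' := gs'_integrable hb k
  have dx : deriv (fun x => ∫ x', gs a x x' * ∫ k', gs b k k' * W x' k') x =
      ∫ x', gs a x x' * ∫ k', gs b k k' * D x' k' := by
    have hP : StronglyMeasurable fun x' => ∫ k', gs b k k' * W x' k' := by
      apply StronglyMeasurable.integral_prod_right
      exact ((gs_cont b k).stronglyMeasurable.comp_measurable measurable_snd).mul hW
    rw [(gi_hasDeriv ha hP (fun t => inner_bound gb (hM t)) x).deriv, swap_int ga' gb hW hM,
      swap_int ga gb hD hN]
    congr 1; ext k'; congr 1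
    have := integral_mul_deriv_eq_deriv_mul_of_integrable (u := gs a x) (v := fun x => W x k')
      (u' := fun t => - gs' a x t) (v' := fun x => D x k')
      (fun t _ => gs_hasDeriv_right a x t) (fun t _ => hWD t k')
      (bdd_int ga (hDk k') (fun t => hN t k')) (bdd_int ga'.neg (hWk k') (fun t => hM t k'))
      (bdd_int ga (hWk k') (fun t => hM t k'))
    rw [this, ← integral_neg]
    congr 1; ext t; ring
  have dk : deriv (fun k => ∫ x', gs a x x' * ∫ k', gs b k k' * W x' k') k =
      ∫ x', gs a x x' * ∫ k', gs' b k k' * W x' k' := by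
    have hQ : StronglyMeasurable fun k' => ∫ x', gs a x x' * W x' k' := by
      apply StronglyMeasurable.integral_prod_right (f := fun k' x' => gs a x x' * W x' k')
      exact ((gs_cont a x).stronglyMeasurable.comp_measurable measurable_snd).mul
        (hW.comp_measurable measurable_swap)
    have e1 : (fun k => ∫ x', gs a x x' * ∫ k', gs b k k' * W x' k') =
        fun k => ∫ k', gs b k k' * ∫ x', gs a x x' * W x' k' :=
      funext fun k => swap_int ga (gs_integrable hb k) hW hM
    rw [e1, (gi_hasDeriv hb hQ (fun t => inner_bound ga (fun s => hM s t)) k).deriv,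
      swap_int ga gb' hW hM]
  rw [dx, dk]
  simp_rw [← integral_const_mul]
  have i1 := (prod_int ga gb hW hM).integral_prod_left
  have i2 := (prod_int ga gb hD hN).integral_prod_left
  have i3 := (prod_int ga gb' hW hM).integral_prod_left
  simp only [Function.uncurry] at i1 i2 i3
  simp_rw [integral_const_mul] at i1 i2 i3 ⊢
  have key : ∀ x', ∫ k', gs b k k' * (2 * π * Complex.I * k' * W x' k' + e * D x' k') =
      2 * π * Complex.I * k * (∫ k', gs b k k' * W x' k') + e * (∫ k', gs b k k' * D x' k')
       + π * Complex.I / b * (∫ k', gs' b k k' * W x' k') := by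
    intro x'
    rw [← lin3 (bdd_int gb (hWx x') (hM x')) (bdd_int gb (hDx x') (hN x'))
      (bdd_int gb' (hWx x') (hM x'))]
    congr 1; ext k'
    simp only [gs', gs]
    have : (b : ℂ) ≠ 0 := by exact_mod_cast hb.ne'
    push_cast
    field_simp
    ring
  simp_rw [key]
  rw [← lin3 i1 i2 i3]
  congr 1; ext x'
  ring

lemma sch_bound (f : SchwartzMap ℝ ℂ) : ∃ C, 0 < C ∧ ∀ x, ‖f x‖ ≤ C := by
  obtain ⟨C, hC, h⟩ := f.decay 0 0
  exact ⟨C, hC, fun x => by simpa using h x⟩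

lemma sch_decay (f : SchwartzMap ℝ ℂ) : ∃ C, 0 < C ∧ ∀ x, ‖f x‖ ≤ C * (1 + x ^ 2)⁻¹ := by
  obtain ⟨C, hC, h⟩ := f.decay 0 0
  obtain ⟨C', hC', h'⟩ := f.decay 2 0
  refine ⟨C + C', by positivity, fun x => ?_⟩
  have h1 := h x
  have h2 := h' x
  simp at h1 h2
  rw [← div_eq_mul_inv, le_div_iff₀ (by positivity)]
  linarith

lemma aff_int {h : ℝ → ℂ} (hh : Integrable h) {ε : ℝ} (hε : 0 < ε) (x : ℝ) :
    Integrable fun y => h (x - ε * y / 2) := by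
  have := (hh.comp_sub_left x).comp_mul_left' (R := ε / 2) (by positivity)
  refine this.congr (Filter.Eventually.of_forall fun y => ?_)
  simp only
  congr 2; ring

/-- integrand -/
noncomputable def wi (ε : ℝ) (f g : ℝ → ℂ) (x k y : ℝ) : ℂ :=
  Complex.exp (-(2 * π * Complex.I * k * y)) *
    f (x + ε * y / 2) * (starRingEnd ℂ) (g (x - ε * y / 2))

lemma norm_ex (k y : ℝ) : ‖Complex.exp (-(2 * π * Complex.I * k * y))‖ = 1 := by
  rw [show (-(2 * π * Complex.I * k * y) : ℂ) = ((-(2 * π * k * y) : ℝ) : ℂ) * Complex.I by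
    push_cast; ring]
  exact Complex.norm_exp_ofReal_mul_I _

lemma wi_norm (ε : ℝ) (f g : ℝ → ℂ) (x k y : ℝ) :
    ‖wi ε f g x k y‖ = ‖f (x + ε * y / 2)‖ * ‖g (x - ε * y / 2)‖ := by
  rw [wi, norm_mul, norm_mul, norm_ex, RCLike.norm_conj, one_mul]

lemma wi_cont (ε : ℝ) (f g : SchwartzMap ℝ ℂ) :
    Continuous fun p : (ℝ × ℝ) × ℝ => wi ε f g p.1.1 p.1.2 p.2 := by
  have hf := f.continuous
  have hg := g.continuous
  unfold wi
  refine Continuous.mul (Continuous.mul (by fun_prop) (hf.comp (by fun_prop)))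
    (Complex.continuous_conj.comp (hg.comp (by fun_prop)))

lemma wi_cont1 (ε : ℝ) (f g : SchwartzMap ℝ ℂ) (x k : ℝ) :
    Continuous fun y => wi ε f g x k y := by
  have hf := f.continuous
  have hg := g.continuous
  unfold wi
  refine Continuous.mul (Continuous.mul (by fun_prop) (hf.comp (by fun_prop)))
    (Complex.continuous_conj.comp (hg.comp (by fun_prop)))

lemma wi_int {ε : ℝ} (hε : 0 < ε) (f g : SchwartzMap ℝ ℂ) (x k : ℝ) :
    Integrable (wi ε f g x k) := by
  obtain ⟨C, hC, h⟩ := sch_bound f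
  refine Integrable.mono' ((aff_int g.integrable hε x).norm.const_mul C)
    (wi_cont1 ε f g x k).aestronglyMeasurable (Filter.Eventually.of_forall fun y => ?_)
  rw [wi_norm]
  gcongr
  exact h _

lemma wig_meas (ε : ℝ) (f g : SchwartzMap ℝ ℂ) :
    StronglyMeasurable (Function.uncurry (wigner ε f g)) := by
  have := (wi_cont ε f g).stronglyMeasurable.integral_prod_right' (ν := volume)
  exact this

lemma wig_bound {ε : ℝ} (hε : 0 < ε) (f g : SchwartzMap ℝ ℂ) :
    ∃ M, ∀ x k, ‖wigner ε f g x k‖ ≤ M := by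
  obtain ⟨C, hC, h⟩ := sch_bound f
  refine ⟨C * (|(ε / 2)⁻¹| * ∫ y, ‖g y‖), fun x k => ?_⟩
  have e : ∫ y, ‖g (x - ε * y / 2)‖ = |(ε / 2)⁻¹| * ∫ y, ‖g y‖ := by
    have h1 := Measure.integral_comp_mul_left (fun y => ‖g (x - y)‖) (ε / 2)
    rw [integral_sub_left_eq_self (fun y => ‖g y‖) volume x, smul_eq_mul] at h1
    rw [← h1]
    congr 1; ext y; congr 3; ring
  rw [← e, ← integral_const_mul]
  refine norm_integral_le_of_norm_le ((aff_int g.integrable hε x).norm.const_mul C)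
    (Filter.Eventually.of_forall fun y => ?_)
  have := wi_norm ε f g x k y
  rw [wi] at this
  rw [this]
  gcongr
  exact h _

/-- Schwartz derivative -/
noncomputable def sd (f : SchwartzMap ℝ ℂ) : SchwartzMap ℝ ℂ := SchwartzMap.derivCLM ℂ ℂ f

lemma sd_hd (f : SchwartzMap ℝ ℂ) (x : ℝ) : HasDerivAt f (sd f x) x := f.hasDerivAt x

lemma conj_hd {g : ℝ → ℂ} {g' : ℂ} {x : ℝ} (h : HasDerivAt g g' x) :
    HasDerivAt (fun x => (starRingEnd ℂ) (g x)) ((starRingEnd ℂ) g') x := h.star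

lemma wig_hasDeriv {ε : ℝ} (hε : 0 < ε) (f g : SchwartzMap ℝ ℂ) (x₀ k : ℝ) :
    HasDerivAt (fun x => wigner ε f g x k) (wigner ε (sd f) g x₀ k + wigner ε f (sd g) x₀ k) x₀ := by
  obtain ⟨A, hA, hfA⟩ := sch_bound f
  obtain ⟨A', hA', hfA'⟩ := sch_bound (sd f)
  obtain ⟨B, hB, hgB⟩ := sch_decay g
  obtain ⟨B', hB', hgB'⟩ := sch_decay (sd g)
  have e : wigner ε (sd f) g x₀ k + wigner ε f (sd g) x₀ k =
      ∫ y, (wi ε (sd f) g x₀ k y + wi ε f (sd g) x₀ k y) :=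
    (integral_add (wi_int hε (sd f) g x₀ k) (wi_int hε f (sd g) x₀ k)).symm
  rw [e]
  refine (hasDerivAt_integral_of_dominated_loc_of_deriv_le (𝕜 := ℝ)
    (F := fun x y => wi ε f g x k y)
    (F' := fun x y => wi ε (sd f) g x k y + wi ε f (sd g) x k y)
    (bound := fun y => (A' * B + A * B') * (3 * (1 + (x₀ - ε * y / 2) ^ 2)⁻¹))
    (Metric.ball_mem_nhds x₀ one_pos) ?_ ?_ ?_ ?_ ?_ ?_).2
  · exact Filter.Eventually.of_forall fun x => (wi_cont1 ε f g x k).aestronglyMeasurable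
  · exact wi_int hε f g x₀ k
  · exact ((wi_int hε (sd f) g x₀ k).add (wi_int hε f (sd g) x₀ k)).aestronglyMeasurable
  · refine Filter.Eventually.of_forall fun y x hx => ?_
    rw [Metric.mem_ball, Real.dist_eq] at hx
    have h0 : (1 + (x - ε * y / 2) ^ 2)⁻¹ ≤ 3 * (1 + (x₀ - ε * y / 2) ^ 2)⁻¹ := by
      rw [← div_eq_mul_inv, le_div_iff₀ (by positivity), inv_mul_le_iff₀ (by positivity)]
      have : (x - x₀) ^ 2 ≤ 1 := by
        rw [← sq_abs]; nlinarith [abs_nonneg (x - x₀)]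
      nlinarith [sq_nonneg ((x - ε * y / 2) + (x - x₀)), sq_nonneg (x - ε * y / 2)]
    refine (norm_add_le _ _).trans ?_
    rw [wi_norm, wi_norm]
    calc _ ≤ A' * (B * (3 * (1 + (x₀ - ε * y / 2) ^ 2)⁻¹))
            + A * (B' * (3 * (1 + (x₀ - ε * y / 2) ^ 2)⁻¹)) := by
          gcongr
          · exact hfA' _
          · exact (hgB _).trans (by gcongr)
          · exact hfA _
          · exact (hgB' _).trans (by gcongr)
      _ = _ := by ring
  · refine Integrable.const_mul (Integrable.const_mul ?_ _) _
    have := (integrable_inv_one_add_sq.comp_sub_left x₀).comp_mul_left' (R := ε / 2) (by positivity)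
    refine this.congr (Filter.Eventually.of_forall fun y => ?_)
    simp only
    congr 4; ring
  · refine Filter.Eventually.of_forall fun y x _ => ?_
    have h1 : HasDerivAt (fun x => f (x + ε * y / 2)) (sd f (x + ε * y / 2)) x :=
      (sd_hd f _).comp_add_const x _
    have h2 : HasDerivAt (fun x => g (x - ε * y / 2)) (sd g (x - ε * y / 2)) x :=
      (sd_hd g _).comp_sub_const x _
    have := (h1.const_mul (Complex.exp (-(2 * π * Complex.I * k * y)))).mul (conj_hd h2)
    exact this

lemma wig_ibp {ε : ℝ} (hε : 0 < ε) (f g : SchwartzMap ℝ ℂ) (x k : ℝ) :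
    (ε : ℂ) * wigner ε (sd f) g x k = 2 * π * Complex.I * k * wigner ε f g x k
      + (ε / 2 : ℂ) * (wigner ε (sd f) g x k + wigner ε f (sd g) x k) := by
  have i0 := wi_int hε f g x k
  have i1 := wi_int hε (sd f) g x k
  have i2 := wi_int hε f (sd g) x k
  have key := integral_eq_zero_of_hasDerivAt_of_integrable (f := wi ε f g x k)
    (f' := fun y => (-(2 * π * Complex.I * k)) * wi ε f g x k y + (ε / 2 : ℂ) * wi ε (sd f) g x k y
      + (-(ε / 2 : ℂ)) * wi ε f (sd g) x k y) ?_
    (((i0.const_mul _).add (i1.const_mul _)).add (i2.const_mul _)) i0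
  · rw [lin3 i0 i1 i2] at key
    change -(2 * π * Complex.I * k) * wigner ε f g x k + (ε / 2 : ℂ) * wigner ε (sd f) g x k
      + (-(ε / 2 : ℂ)) * wigner ε f (sd g) x k = 0 at key
    linear_combination key
  · intro y
    have l1 : HasDerivAt (fun y : ℝ => x + ε * y / 2) (ε / 2) y := by
      simpa using (((hasDerivAt_id y).const_mul ε).div_const 2).const_add x
    have l2 : HasDerivAt (fun y : ℝ => x - ε * y / 2) (-(ε / 2)) y := by
      simpa using (((hasDerivAt_id y).const_mul ε).div_const 2).const_sub x
    have h1 := (sd_hd f (x + ε * y / 2)).scomp y l1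
    have h2 := conj_hd ((sd_hd g (x - ε * y / 2)).scomp y l2)
    have h3 : HasDerivAt (fun y : ℝ => Complex.exp (-(2 * π * Complex.I * k * y)))
        (Complex.exp (-(2 * π * Complex.I * k * y)) * (-(2 * π * Complex.I * k))) y := by
      have := (((Complex.ofRealCLM.hasDerivAt (x := y)).const_mul (2 * π * Complex.I * k)).neg).cexp
      simpa using this
    have := (h3.mul h1).mul h2
    refine this.congr_deriv ?_
    simp only [wi, Pi.mul_apply, Function.comp_apply, Complex.real_smul, map_mul, Complex.conj_ofReal]
    push_cast
    ring

lemma swt_eq (ε σx σk : ℝ) (f g : ℝ → ℂ) (x k : ℝ) :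
    swt ε σx σk f g x k = (2 / (ε * σx * σk) : ℂ) *
      ∫ x', gs (2 * π / (ε * σx ^ 2)) x x' *
        ∫ k', gs (2 * π / (ε * σk ^ 2)) k k' * wigner ε f g x' k' := by
  unfold swt
  congr 2; ext x'
  rw [← integral_const_mul]
  congr 1; ext k'
  rw [← mul_assoc]
  congr 1
  unfold gs
  rw [← Complex.ofReal_mul, ← Real.exp_add]
  congr 2
  ring

/-- Identity (3c): the SWT of `(ε f', g)` in terms of the SWT of `(f,g)` and its
phase-space derivatives. -/
theorem swt_deriv_left (ε σx σk : ℝ) (hε : 0 < ε) (hσx : 0 < σx) (hσk : 0 < σk)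
    (f g : SchwartzMap ℝ ℂ) (x k : ℝ) :
    swt ε σx σk (fun y => (ε : ℂ) * deriv (⇑f) y) (⇑g) x k =
      2 * π * Complex.I * k * swt ε σx σk (⇑f) (⇑g) x k
      + (ε / 2 : ℂ) * deriv (fun x' => swt ε σx σk (⇑f) (⇑g) x' k) x
      + Complex.I * ε * σk ^ 2 / 2 * deriv (fun k' => swt ε σx σk (⇑f) (⇑g) x k') k := by

  have ha : 0 < 2 * π / (ε * σx ^ 2) := by positivity
  have hb : 0 < 2 * π / (ε * σk ^ 2) := by positivity
  have hA : ∀ x' k', wigner ε (fun y => (ε : ℂ) * deriv (⇑f) y) g x' k' =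
      2 * π * Complex.I * k' * wigner ε f g x' k'
      + (ε / 2 : ℂ) * (wigner ε (sd f) g x' k' + wigner ε f (sd g) x' k') := by
    intro x' k'
    rw [← wig_ibp hε f g x' k']
    unfold wigner
    rw [← integral_const_mul]
    congr 1; ext y
    rw [show sd f (x' + ε * y / 2) = deriv f (x' + ε * y / 2) from rfl]
    ring
  obtain ⟨M, hM⟩ := wig_bound hε f g
  obtain ⟨N₁, hN₁⟩ := wig_bound hε (sd f) g
  obtain ⟨N₂, hN₂⟩ := wig_bound hε f (sd g)
  have c := core ha hb (wig_meas ε f g) ((wig_meas ε (sd f) g).add (wig_meas ε f (sd g)))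
    (D := fun x k => wigner ε (sd f) g x k + wigner ε f (sd g) x k)
    hM (fun x k => (norm_add_le _ _).trans (add_le_add (hN₁ x k) (hN₂ x k)))
    (wig_hasDeriv hε f g) (ε / 2 : ℂ) x k
  simp_rw [swt_eq, hA]
  rw [deriv_const_mul_field, deriv_const_mul_field, c]
  have h1 : (ε : ℂ) ≠ 0 := by exact_mod_cast hε.ne'
  have h2 : (σk : ℂ) ≠ 0 := by exact_mod_cast hσk.ne'
  have h3 : (π : ℂ) ≠ 0 := by exact_mod_cast Real.pi_ne_zero
  have h4 : (π * Complex.I / ((2 * π / (ε * σk ^ 2) : ℝ) : ℂ)) = Complex.I * ε * σk ^ 2 / 2 := by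
    push_cast
    field_simp
  rw [h4]
  ring
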